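/- arXiv:1701.03877 — 8 statements merged into one kernel-verified Lean document; each statement's English description precedes it below -/
import Mathlib

section
/- For any zero-error multi-sender index code and any acyclically orderable set S ⊆ {1,...,N}, the product of the message-alphabet sizes over S is bounded by the product of the codeword-alphabet sizes over the senders whose message sets intersect S: ∏_{j∈S} |M_j| ≤ ∏_{k : S_k ∩ S ≠ ∅} |L_k|. (This is the multi-sender maximal-acyclic-induced-subgraph (MAIS) outer bound, Proposition 1, in zero-error combinatorial form.) -/
/-- A zero-error multi-sender index code: sender `k` knows the messages indexed by `S k`,
receiver `j` knows the messages indexed by `A j` and must decode message `j`. -/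
structure MultiSenderCode (N K : ℕ) (S : Fin K → Finset (Fin N)) (A : Fin N → Finset (Fin N))
    (Mt : Fin N → Type) (Lt : Fin K → Type) where
  f : ∀ k : Fin K, ((i : {i : Fin N // i ∈ S k}) → Mt i.1) → Lt k
  g : ∀ j : Fin N, (∀ k : Fin K, Lt k) → ((i : {i : Fin N // i ∈ A j}) → Mt i.1) → Mt j
  correct : ∀ (m : ∀ i : Fin N, Mt i) (j : Fin N),
    g j (fun k => f k (fun i => m i.1)) (fun i => m i.1) = m j

/-- A set `Sset` of receivers is acyclically orderable if its elements can be enumerated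
`j_1, …, j_m` so that the side information of `j_t` inside `Sset` is contained in
`{j_1, …, j_{t-1}}`. -/
def AcyclicOrderable {N : ℕ} (A : Fin N → Finset (Fin N)) (Sset : Finset (Fin N)) : Prop :=
  ∃ l : List (Fin N), l.Nodup ∧ l.toFinset = Sset ∧
    ∀ (t : ℕ) (ht : t < l.length), ∀ x ∈ A (l.get ⟨t, ht⟩), x ∈ Sset → x ∈ l.take t

/-- Two message tuples with the same codewords that agree outside an acyclically orderable set
are equal. -/
theorem MultiSenderCode.eq_of_acyclicOrderable {N K : ℕ} {S : Fin K → Finset (Fin N)}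
    {A : Fin N → Finset (Fin N)} {Mt : Fin N → Type} {Lt : Fin K → Type}
    (code : MultiSenderCode N K S A Mt Lt) {Sset : Finset (Fin N)}
    (hS : AcyclicOrderable A Sset) {m m' : ∀ i, Mt i}
    (hcode : ∀ k, code.f k (fun i => m i.1) = code.f k (fun i => m' i.1))
    (hout : ∀ i ∉ Sset, m i = m' i) : m = m' := by
  obtain ⟨l, -, rfl, hl⟩ := hS
  have key : ∀ (t : ℕ) (ht : t < l.length), m (l.get ⟨t, ht⟩) = m' (l.get ⟨t, ht⟩) := by
    intro t
    induction t using Nat.strong_induction_on with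
    | _ t ih =>
      intro ht
      have hside : (fun i : {i : Fin N // i ∈ A (l.get ⟨t, ht⟩)} => m i.1) =
          fun i : {i : Fin N // i ∈ A (l.get ⟨t, ht⟩)} => m' i.1 := by
        funext ⟨x, hx⟩
        by_cases hxS : x ∈ l.toFinset
        · obtain ⟨s, hs, rfl⟩ := List.mem_take_iff_getElem.1 (hl t ht x hx hxS)
          exact ih s (by omega) (by omega)
        · exact hout x hxS
      rw [← code.correct m, ← code.correct m', hside, funext hcode]
  funext i
  by_cases hi : i ∈ l.toFinset
  · obtain ⟨n, rfl⟩ := List.mem_iff_get.1 (List.mem_toFinset.1 hi)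
    exact key n.1 n.2
  · exact hout i hi

/-- The multi-sender MAIS outer bound (Proposition 1) in zero-error combinatorial form. -/
theorem multiSender_MAIS_bound {N K : ℕ} {S : Fin K → Finset (Fin N)}
    {A : Fin N → Finset (Fin N)} {Mt : Fin N → Type} {Lt : Fin K → Type}
    [∀ i, Fintype (Mt i)] [∀ i, Nonempty (Mt i)] [∀ k, Fintype (Lt k)]
    (hA : ∀ j : Fin N, j ∉ A j)
    (code : MultiSenderCode N K S A Mt Lt)
    (Sset : Finset (Fin N)) (hS : AcyclicOrderable A Sset) :
    ∏ j ∈ Sset, Fintype.card (Mt j) ≤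
      ∏ k ∈ Finset.univ.filter (fun k => (S k ∩ Sset).Nonempty), Fintype.card (Lt k) := by
  classical
  let m₀ : ∀ i, Mt i := fun i => Classical.arbitrary (Mt i)
  let ext (m : (j : Sset) → Mt j) (i : Fin N) : Mt i := if h : i ∈ Sset then m ⟨i, h⟩ else m₀ i
  let active := Finset.univ.filter fun k => (S k ∩ Sset).Nonempty
  let enc (m : (j : Sset) → Mt j) (k : active) : Lt k := code.f k fun i => ext m i.1
  have hinj : Function.Injective enc := by
    intro m m' h
    have hext : ext m = ext m' := by
      refine code.eq_of_acyclicOrderable hS (fun k => ?_) fun i hi => by simp [ext, hi]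
      by_cases hk : k ∈ active
      · exact congrFun h ⟨k, hk⟩
      · congr 1
        funext i
        have hi : i.1 ∉ Sset := fun hi =>
          hk (Finset.mem_filter.2 ⟨Finset.mem_univ k, i.1, Finset.mem_inter.2 ⟨i.2, hi⟩⟩)
        simp [ext, hi]
    funext j
    simpa [ext] using congrFun hext j
  have hcard := Fintype.card_le_of_injective enc hinj
  rw [Fintype.card_pi, Fintype.card_pi,
    Finset.prod_coe_sort Sset fun j => Fintype.card (Mt j),
    Finset.prod_coe_sort active fun k => Fintype.card (Lt k)] at hcard
  exact hcard
end

section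
/- For any zero-error multi-sender index code, any acyclically orderable set S ⊆ {1,...,N}, and any fixed assignment of the messages (m_i)_{i ∉ S}, the map sending a tuple (m_j)_{j∈S} of messages indexed by S to the tuple of encoder outputs (f_k applied to its inputs)_{k : S_k ∩ S ≠ ∅} is injective. -/
/-- Message tuples with the same codewords that agree on the side information of receiver `j`
agree at `j`. -/
theorem MultiSenderCode.apply_eq_of_agree {N K : ℕ} {S : Fin K → Finset (Fin N)}
    {A : Fin N → Finset (Fin N)} {Mt : Fin N → Type} {Lt : Fin K → Type}
    (code : MultiSenderCode N K S A Mt Lt) {m m' : ∀ i : Fin N, Mt i}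
    (hf : ∀ k, code.f k (fun i => m i.1) = code.f k (fun i => m' i.1))
    {j : Fin N} (hA : ∀ i ∈ A j, m i = m' i) : m j = m' j := by
  have hside : (fun i : {i : Fin N // i ∈ A j} => m i.1) =
      fun i : {i : Fin N // i ∈ A j} => m' i.1 :=
    funext fun i => hA i.1 i.2
  rw [← code.correct m j, ← code.correct m' j, funext hf, hside]

/-- Induction along the order of an acyclically orderable set. -/
theorem AcyclicOrderable.induction_on {N : ℕ} {A : Fin N → Finset (Fin N)}
    {Sset : Finset (Fin N)} (hS : AcyclicOrderable A Sset) {P : Fin N → Prop}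
    (step : ∀ j ∈ Sset, (∀ x ∈ A j, x ∈ Sset → P x) → P j) {j : Fin N} (hj : j ∈ Sset) :
    P j := by
  obtain ⟨l, -, rfl, hl⟩ := hS
  have key : ∀ (t : ℕ) (ht : t < l.length), P l[t] := by
    intro t
    induction t using Nat.strong_induction_on with
    | _ t ih =>
      intro ht
      refine step _ (List.mem_toFinset.2 (List.getElem_mem ht)) fun x hx hxS => ?_
      obtain ⟨s, hs, rfl⟩ := List.mem_take_iff_getElem.1 (hl t ht x hx hxS)
      exact ih s (lt_of_lt_of_le hs (min_le_left _ _)) _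
  obtain ⟨t, ht, rfl⟩ := List.getElem_of_mem (List.mem_toFinset.1 hj)
  exact key t ht

/-- For any zero-error multi-sender index code, any acyclically orderable set `Sset` and any
fixed assignment `m0` of the messages outside `Sset`, the map from the messages indexed by
`Sset` to the tuple of outputs of the senders whose message sets intersect `Sset` is
injective. -/
theorem multiSender_MAIS_injective {N K : ℕ} {S : Fin K → Finset (Fin N)}
    {A : Fin N → Finset (Fin N)} {Mt : Fin N → Type} {Lt : Fin K → Type}
    [∀ i, Fintype (Mt i)] [∀ i, Nonempty (Mt i)] [∀ k, Fintype (Lt k)]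
    (hA : ∀ j : Fin N, j ∉ A j)
    (code : MultiSenderCode N K S A Mt Lt)
    (Sset : Finset (Fin N)) (hS : AcyclicOrderable A Sset)
    (m0 : ∀ i : Fin N, Mt i) :
    Function.Injective
      (fun mS : (j : {j : Fin N // j ∈ Sset}) → Mt j.1 =>
        (fun k : {k : Fin K // (S k ∩ Sset).Nonempty} =>
          code.f k.1 (fun i => if h : i.1 ∈ Sset then mS ⟨i.1, h⟩ else m0 i.1))) := by
  intro a b hab
  let ext (c : (j : {j : Fin N // j ∈ Sset}) → Mt j.1) (i : Fin N) : Mt i :=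
    if h : i ∈ Sset then c ⟨i, h⟩ else m0 i
  have ext_notMem : ∀ i ∉ Sset, ext a i = ext b i := fun i hi => by simp [ext, hi]
  have hf : ∀ k, code.f k (fun i => ext a i.1) = code.f k (fun i => ext b i.1) := by
    intro k
    by_cases hk : (S k ∩ Sset).Nonempty
    · exact congrFun hab ⟨k, hk⟩
    · congr 1
      funext i
      exact ext_notMem i.1 fun hi => hk ⟨i.1, Finset.mem_inter.2 ⟨i.2, hi⟩⟩
  funext ⟨j, hj⟩
  have h : ext a j = ext b j := hS.induction_on (P := fun j => ext a j = ext b j)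
    (fun j _ ih => code.apply_eq_of_agree hf fun i hi =>
      if hiS : i ∈ Sset then ih i hi hiS else ext_notMem i hiS) hj
  simpa [ext, hj] using h
end

section
/- The set of tuples (R1,R2,R3,R4) ∈ ℝ⁴ with all Rj ≥ 0 for which there exist real numbers γ1, γ23, γ4 ≥ 0 satisfying R1 < γ1, R2 < γ23, R3 < γ23, R4 < γ4, γ1 < 1, γ4 < 1, γ1 + γ23 < 2, γ4 + γ23 < 2, and γ1 + γ4 < 2, equals the set {(R1,R2,R3,R4) ∈ ℝ⁴ : Rj ≥ 0 for all j, R1 < 1, R4 < 1, R1 + R2 < 2, R1 + R3 < 2, R2 + R4 < 2, R3 + R4 < 2}. (This shows cooperative composite coding achieves the MAIS outer bound in Example 1.) -/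
/-- Cooperative composite coding achieves the MAIS outer bound in Example 1: eliminating
the composite rates `γ1, γ23, γ4` (shared index `γ23` for the common composite message)
yields exactly the MAIS region. Here `R 0, R 1, R 2, R 3` play the roles of
`R1, R2, R3, R4`. -/
theorem example1_CCC_FME :
    {R : Fin 4 → ℝ | (∀ j, 0 ≤ R j) ∧
        ∃ γ1 γ23 γ4 : ℝ, 0 ≤ γ1 ∧ 0 ≤ γ23 ∧ 0 ≤ γ4 ∧
          R 0 < γ1 ∧ R 1 < γ23 ∧ R 2 < γ23 ∧ R 3 < γ4 ∧
          γ1 < 1 ∧ γ4 < 1 ∧ γ1 + γ23 < 2 ∧ γ4 + γ23 < 2 ∧ γ1 + γ4 < 2} =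
    {R : Fin 4 → ℝ | (∀ j, 0 ≤ R j) ∧ R 0 < 1 ∧ R 3 < 1 ∧
        R 0 + R 1 < 2 ∧ R 0 + R 2 < 2 ∧ R 1 + R 3 < 2 ∧ R 2 + R 3 < 2} := by
  ext R
  simp only [Set.mem_ofPred_eq]
  constructor
  · rintro ⟨hR, γ1, γ23, γ4, -, -, -, h0, h1, h2, h3, h4, h5, h6, h7, -⟩
    refine ⟨hR, ?_, ?_, ?_, ?_, ?_, ?_⟩ <;> linarith
  · rintro ⟨hR, h0, h3, h01, h02, h13, h23⟩
    obtain ⟨M, hM0, hM3, hM, hM1, hM2⟩ :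
        ∃ M, R 0 ≤ M ∧ R 3 ≤ M ∧ M < 1 ∧ M + R 1 < 2 ∧ M + R 2 < 2 := by
      rcases le_total (R 0) (R 3) with h | h
      · exact ⟨R 3, h, le_rfl, h3, by linarith, by linarith⟩
      · exact ⟨R 0, le_rfl, h, h0, by linarith, by linarith⟩
    obtain ⟨γ, hγM, hγ⟩ : ∃ γ, M < γ ∧ γ < min 1 (min (2 - R 1) (2 - R 2)) :=
      exists_between (lt_min hM (lt_min (by linarith) (by linarith)))
    obtain ⟨hγ1, hγR1, hγR2⟩ : γ < 1 ∧ γ < 2 - R 1 ∧ γ < 2 - R 2 := by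
      simpa only [lt_min_iff] using hγ
    obtain ⟨γ23, hγ23, hγ23'⟩ : ∃ γ23, max (R 1) (R 2) < γ23 ∧ γ23 < 2 - γ :=
      exists_between (max_lt (by linarith) (by linarith))
    obtain ⟨hR1, hR2⟩ := max_lt_iff.mp hγ23
    have := hR 0
    have := hR 1
    refine ⟨hR, γ, γ23, γ, ?_, ?_, ?_, ?_, ?_, ?_, ?_, ?_, ?_, ?_, ?_, ?_⟩ <;> linarith
end

section
/- Let R1reg = {(R1,R2,R3,R4) ∈ ℝ⁴ : Rj ≥ 0 for all j, R1 < 1, R4 < 1, R1 + R3 + R4 < 2, R1 + R2 + R4 < 2} and R2reg = {(R1,R2,R3,R4) ∈ ℝ⁴ : Rj ≥ 0 for all j, R1 < 1, R4 < 1, R3 + R4 < 2, R2 + R4 < 2, R1 + R2 + R3 < 2}. Then the convex hull of R1reg ∪ R2reg equals {(R1,R2,R3,R4) ∈ ℝ⁴ : Rj ≥ 0 for all j, R1 < 1, R4 < 1, R1 + R2 < 2, R1 + R3 < 2, R2 + R4 < 2, R3 + R4 < 2, R1 + R2 + R3 + 2R4 < 4, 2R1 + R2 + R3 + R4 < 4}.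 -/
/-- The region achieved by partitioned DCC in Example 1 under decoding choice (i). -/
def R1reg : Set (Fin 4 → ℝ) :=
  {R | (∀ j, 0 ≤ R j) ∧ R 0 < 1 ∧ R 3 < 1 ∧
      R 0 + R 2 + R 3 < 2 ∧ R 0 + R 1 + R 3 < 2}

/-- The region achieved by partitioned DCC in Example 1 under decoding choice (ii). -/
def R2reg : Set (Fin 4 → ℝ) :=
  {R | (∀ j, 0 ≤ R j) ∧ R 0 < 1 ∧ R 3 < 1 ∧
      R 2 + R 3 < 2 ∧ R 1 + R 3 < 2 ∧ R 0 + R 1 + R 2 < 2}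

open Filter Topology in
/-- A strict inequality `x < k` survives scaling `k` by factors slightly below one. -/
lemma eventually_lt_mul_nhdsLT_one {x k : ℝ} (h : x < k) : ∀ᶠ r in 𝓝[<] (1 : ℝ), x < r * k := by
  have hc : Tendsto (fun r : ℝ => r * k) (𝓝[<] 1) (𝓝 (1 * k)) :=
    ((continuous_id.mul continuous_const).tendsto 1).mono_left nhdsWithin_le_nhds
  exact hc.eventually_const_lt (by simpa using h)

/-- The outer region in the statement is convex. -/
lemma convex_timeSharing_region :
    Convex ℝ {R : Fin 4 → ℝ | (∀ j, 0 ≤ R j) ∧ R 0 < 1 ∧ R 3 < 1 ∧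
        R 0 + R 1 < 2 ∧ R 0 + R 2 < 2 ∧ R 1 + R 3 < 2 ∧ R 2 + R 3 < 2 ∧
        R 0 + R 1 + R 2 + 2 * R 3 < 4 ∧ 2 * R 0 + R 1 + R 2 + R 3 < 4} := by
  rw [convex_iff_forall_pos]
  rintro x ⟨x0, x1, x2, x3, x4, x5, x6, x7, x8⟩ y ⟨y0, y1, y2, y3, y4, y5, y6, y7, y8⟩
    a b ha hb hab
  have key : ∀ {u v k : ℝ}, u < k → v < k → a * u + b * v < k := fun {u v k} hu hv => by
    have h1 := mul_lt_mul_of_pos_left hu ha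
    have h2 := mul_lt_mul_of_pos_left hv hb
    have h3 : a * k + b * k = k := by rw [← add_mul, hab, one_mul]
    linarith
  simp only [Set.mem_ofPred_eq, Pi.add_apply, Pi.smul_apply, smul_eq_mul]
  refine ⟨fun j => add_nonneg (mul_nonneg ha.le (x0 j)) (mul_nonneg hb.le (y0 j)),
    key x1 y1, key x2 y2, ?_, ?_, ?_, ?_, ?_, ?_⟩
  · linarith [key x3 y3]
  · linarith [key x4 y4]
  · linarith [key x5 y5]
  · linarith [key x6 y6]
  · linarith [key x7 y7]
  · linarith [key x8 y8]

/-- The common share `n` of the outer two rates is put on the point `(1, x, y, 1)`, and what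
exceeds the capacity `2 - m - n` of the remaining share is carried by `x` and `y`. -/
lemma exists_shares {n m b c : ℝ} (hn : 0 ≤ n) (hb : 0 ≤ b) (hc : 0 ≤ c) (hmn : m + n ≤ 2)
    (hbm : b ≤ 2 - m) (hcm : c ≤ 2 - m) (hbc : b + c ≤ 4 - 2 * m - n) :
    ∃ x y : ℝ, 0 ≤ x ∧ 0 ≤ y ∧ x + y ≤ 1 ∧ n * x ≤ b ∧ n * y ≤ c ∧
      b - n * x ≤ 2 - m - n ∧ c - n * y ≤ 2 - m - n := by
  rcases hn.eq_or_lt with rfl | hn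
  · exact ⟨0, 0, by norm_num, by norm_num, by norm_num, by linarith, by linarith,
      by linarith, by linarith⟩
  · refine ⟨max 0 (b - (2 - m - n)) / n, max 0 (c - (2 - m - n)) / n, by positivity,
      by positivity, ?_, ?_⟩
    · rw [← add_div, div_le_one hn]
      rcases max_cases 0 (b - (2 - m - n)) with h | h <;>
      rcases max_cases 0 (c - (2 - m - n)) with h' | h' <;> linarith
    · rw [mul_div_cancel₀ _ hn.ne', mul_div_cancel₀ _ hn.ne']
      have h1 := le_max_right 0 (b - (2 - m - n))
      have h2 := le_max_right 0 (c - (2 - m - n))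
      exact ⟨max_le hb (by linarith), max_le hc (by linarith), by linarith, by linarith⟩

/-- Time sharing (convex hull) between the two decoding choices gives the best partitioned
DCC region of Example 1. Here `R 0, R 1, R 2, R 3` play the roles of `R1, R2, R3, R4`. -/
theorem example1_DCC_convex_hull :
    convexHull ℝ (R1reg ∪ R2reg) =
    {R : Fin 4 → ℝ | (∀ j, 0 ≤ R j) ∧ R 0 < 1 ∧ R 3 < 1 ∧
        R 0 + R 1 < 2 ∧ R 0 + R 2 < 2 ∧ R 1 + R 3 < 2 ∧ R 2 + R 3 < 2 ∧
        R 0 + R 1 + R 2 + 2 * R 3 < 4 ∧ 2 * R 0 + R 1 + R 2 + R 3 < 4} := by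
  apply Set.Subset.antisymm
  · refine convexHull_min ?_ convex_timeSharing_region
    rintro R (⟨h, h1, h2, h3, h4⟩ | ⟨h, h1, h2, h3, h4, h5⟩) <;>
    · have := h 0
      have := h 1
      have := h 2
      have := h 3
      refine ⟨h, h1, h2, ?_, ?_, ?_, ?_, ?_, ?_⟩ <;> linarith
  · rintro R ⟨h, h1, h2, h3, h4, h5, h6, h7, h8⟩
    obtain ⟨r, g1, g2, g3, g4, g5, g6, g7, g8, hr0, hr1⟩ :=
      ((eventually_lt_mul_nhdsLT_one h1).and <| (eventually_lt_mul_nhdsLT_one h2).and <|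
        (eventually_lt_mul_nhdsLT_one h3).and <| (eventually_lt_mul_nhdsLT_one h4).and <|
        (eventually_lt_mul_nhdsLT_one h5).and <| (eventually_lt_mul_nhdsLT_one h6).and <|
        (eventually_lt_mul_nhdsLT_one h7).and <| (eventually_lt_mul_nhdsLT_one h8).and <|
        (eventually_lt_mul_nhdsLT_one one_pos).and eventually_mem_nhdsWithin).exists
    rw [mul_one] at hr0
    replace hr1 : r < 1 := hr1
    obtain ⟨S, rfl⟩ : ∃ S : Fin 4 → ℝ, R = r • S := ⟨r⁻¹ • R, by rw [smul_inv_smul₀ hr0.ne']⟩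
    simp only [Pi.smul_apply, smul_eq_mul] at h g1 g2 g3 g4 g5 g6 g7 g8
    have hS : ∀ j, 0 ≤ S j := fun j => nonneg_of_mul_nonneg_right (h j) hr0
    have scale : ∀ {u k : ℝ}, r * u < r * k → u < k := fun hu => lt_of_mul_lt_mul_left hu hr0.le
    replace g1 : S 0 < 1 := scale g1
    replace g2 : S 3 < 1 := scale g2
    replace g3 : S 0 + S 1 < 2 := scale (by linarith)
    replace g4 : S 0 + S 2 < 2 := scale (by linarith)
    replace g5 : S 1 + S 3 < 2 := scale (by linarith)
    replace g6 : S 2 + S 3 < 2 := scale (by linarith)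
    replace g7 : S 0 + S 1 + S 2 + 2 * S 3 < 4 := scale (by linarith)
    replace g8 : 2 * S 0 + S 1 + S 2 + S 3 < 4 := scale (by linarith)
    obtain ⟨n, m, hn, hn0, hn3, hn1, hm, hm0, hm1, hm2, hm3⟩ : ∃ n m : ℝ, 0 ≤ n ∧ n ≤ S 0 ∧
        n ≤ S 3 ∧ n < 1 ∧ m + n = S 0 + S 3 ∧ m < 1 ∧ S 1 ≤ 2 - m ∧ S 2 ≤ 2 - m ∧
        S 1 + S 2 ≤ 4 - 2 * m - n := by
      rcases le_total (S 0) (S 3) with hle | hle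
      · refine ⟨S 0, S 3, hS 0, ?_, ?_, ?_, ?_, ?_, ?_, ?_, ?_⟩ <;> linarith
      · refine ⟨S 3, S 0, hS 3, ?_, ?_, ?_, ?_, ?_, ?_, ?_, ?_⟩ <;> linarith
    obtain ⟨x, y, hx, hy, hxy, hnx, hny, hbx, hcy⟩ :=
      exists_shares hn (hS 1) (hS 2) (by linarith) hm1 hm2 hm3
    have hn' : 0 < 1 - n := by linarith
    have hq : 0 < r / (1 - n) := div_pos hr0 hn'
    have hqn : r / (1 - n) * (1 - n) = r := div_mul_cancel₀ _ hn'.ne'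
    have bound : ∀ {u k : ℝ}, 0 < k → u ≤ k * (1 - n) → r / (1 - n) * u < k := by
      intro u k hk hu
      calc r / (1 - n) * u ≤ r / (1 - n) * (k * (1 - n)) := by gcongr
        _ = r * k := by rw [mul_left_comm, hqn, mul_comm]
        _ < k := mul_lt_of_lt_one_left hk hr1
    have hA : (r / (1 - n)) • ![S 0 - n, S 1 - n * x, S 2 - n * y, S 3 - n] ∈ R1reg := by
      refine ⟨fun j => mul_nonneg hq.le ?_, bound one_pos ?_, bound one_pos ?_, ?_, ?_⟩
      · fin_cases j <;> simp <;> linarith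
      · simp; linarith
      · simp; linarith
      · simp only [Pi.smul_apply, smul_eq_mul, ← mul_add]
        refine bound two_pos ?_
        simp; linarith
      · simp only [Pi.smul_apply, smul_eq_mul, ← mul_add]
        refine bound two_pos ?_
        simp; linarith
    have hB : r • ![1, x, y, 1] ∈ R2reg := by
      have lt_two : ∀ {u : ℝ}, u ≤ 2 → r * u < 2 := fun {u} hu => by
        have := mul_le_mul_of_nonneg_left hu hr0.le
        linarith
      refine ⟨fun j => mul_nonneg hr0.le ?_, ?_, ?_, ?_, ?_, ?_⟩
      · fin_cases j <;> simp <;> linarith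
      · simpa using hr1
      · simpa using hr1
      all_goals
        simp only [Pi.smul_apply, smul_eq_mul, ← mul_add]
        refine lt_two ?_
        simp; linarith
    have hAB := convex_convexHull ℝ (R1reg ∪ R2reg) (subset_convexHull ℝ _ (Or.inl hA))
      (subset_convexHull ℝ _ (Or.inr hB)) hn'.le hn (sub_add_cancel 1 n)
    convert hAB using 1
    rw [smul_smul, mul_comm (1 - n), hqn, smul_comm n r, ← smul_add]
    congr 1
    ext j
    fin_cases j <;> simp
end

section
/- For any zero-error multi-sender index code for the 15-sender configuration of Example 2 (message-index sets S_1={1}, S_2={2}, S_3={3}, S_4={4}, S_5={1,2}, S_6={1,3}, S_7={3,4}, S_8={2,3}, S_9={2,4}, S_10={1,4}, S_11={1,2,3}, S_12={1,2,4}, S_13={1,3,4}, S_14={2,3,4}, S_15={1,2,3,4}; side information A_1={4}, A_2={3,4}, A_3={1,2}, A_4={2,3}), the following cardinality bounds hold: for each j ∈ {1,2,3,4}, |M_j| ≤ ∏_{k : j ∈ S_k} |L_k|; and for each pair P ∈ {{1,2},{1,3},{1,4},{3,4}}, ∏_{j∈P} |M_j| ≤ ∏_{k : S_k ∩ P ≠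 ∅} |L_k|. (These are the MAIS bounds R_j ≤ 8 and the pair bounds ≤ 12 for Example 2 when every |L_k| ≤ 2^n.) -/
/-- The 15 sender message-index sets of Example 2 (0-indexed). -/
def Sconf15 : Fin 15 → Finset (Fin 4)
  | 0 => {0} | 1 => {1} | 2 => {2} | 3 => {3}
  | 4 => {0, 1} | 5 => {0, 2} | 6 => {2, 3} | 7 => {1, 2} | 8 => {1, 3} | 9 => {0, 3}
  | 10 => {0, 1, 2} | 11 => {0, 1, 3} | 12 => {0, 2, 3} | 13 => {1, 2, 3} | 14 => {0, 1, 2, 3}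

/-- The side information of Example 2 (0-indexed): `A_1={4}`, `A_2={3,4}`, `A_3={1,2}`,
`A_4={2,3}`. -/
def Aconf15 : Fin 4 → Finset (Fin 4)
  | 0 => {3} | 1 => {2, 3} | 2 => {0, 1} | 3 => {1, 2}

namespace MultiSenderCode

variable {N K : ℕ} {S : Fin K → Finset (Fin N)} {A : Fin N → Finset (Fin N)}
  {Mt : Fin N → Type} {Lt : Fin K → Type}

/-- Two message tuples that agree outside a set `P` on which the side information is acyclic
(as witnessed by the rank `r`), and have the same codewords, are equal. -/
theorem eq_of_codewords_eq (code : MultiSenderCode N K S A Mt Lt) {P : Finset (Fin N)}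
    {r : Fin N → ℕ} (hr : ∀ j ∈ P, ∀ i ∈ A j, i ∈ P → r i < r j) {m m' : ∀ i, Mt i}
    (hout : ∀ i ∉ P, m i = m' i)
    (hcode : ∀ k, code.f k (fun i => m i.1) = code.f k (fun i => m' i.1)) : m = m' := by
  have key : ∀ n j, r j = n → m j = m' j := by
    intro n
    induction n using Nat.strong_induction_on with
    | _ n ih =>
      rintro j rfl
      by_cases hj : j ∈ P
      · have hside : (fun i : {i // i ∈ A j} => m i.1) =
            fun i : {i // i ∈ A j} => m' i.1 := by
          funext i
          by_cases hi : i.1 ∈ P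
          · exact ih _ (hr j hj i.1 i.2 hi) i.1 rfl
          · exact hout i.1 hi
        rw [← code.correct m j, ← code.correct m' j, funext hcode, hside]
      · exact hout j hj
  exact funext fun j => key _ j rfl

/-- The maximum acyclic induced subgraph (MAIS) bound in cardinality form: if the side information
is acyclic on `P`, the messages in `P` are jointly bounded by the codewords of the senders that
know some message of `P`. -/
theorem prod_card_le_of_acyclic [∀ i, Fintype (Mt i)] [∀ i, Nonempty (Mt i)]
    [∀ k, Fintype (Lt k)] (code : MultiSenderCode N K S A Mt Lt) (P : Finset (Fin N))
    (r : Fin N → ℕ) (hr : ∀ j ∈ P, ∀ i ∈ A j, i ∈ P → r i < r j) :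
    ∏ j ∈ P, Fintype.card (Mt j) ≤
      ∏ k ∈ Finset.univ.filter (fun k => (S k ∩ P).Nonempty), Fintype.card (Lt k) := by
  classical
  set T := Finset.univ.filter (fun k => (S k ∩ P).Nonempty) with hT
  let ext (x : ∀ j : P, Mt j) (i : Fin N) : Mt i :=
    if h : i ∈ P then x ⟨i, h⟩ else Classical.arbitrary (Mt i)
  let F (x : ∀ j : P, Mt j) (k : T) : Lt k := code.f k (fun i => ext x i.1)
  have hF : Function.Injective F := by
    intro x y hxy
    have hout : ∀ i ∉ P, ext x i = ext y i := fun i hi => by simp [ext, hi]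
    have hext : ext x = ext y := by
      refine code.eq_of_codewords_eq hr hout fun k => ?_
      by_cases hk : k ∈ T
      · exact congrFun hxy ⟨k, hk⟩
      · congr 1
        funext i
        refine hout i.1 fun hi => hk ?_
        simpa [hT] using ⟨i.1, Finset.mem_inter.2 ⟨i.2, hi⟩⟩
    funext j
    simpa [ext] using congrFun hext j
  have hcard := Fintype.card_le_of_injective F hF
  rwa [Fintype.card_pi, Fintype.card_pi, Finset.prod_coe_sort P fun j => Fintype.card (Mt j),
    Finset.prod_coe_sort T fun k => Fintype.card (Lt k)] at hcard

end MultiSenderCode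

/-- The MAIS single-rate and pair-rate bounds for Example 2 in zero-error combinatorial
form: for each message `j`, `|M_j| ≤ ∏_{k : j ∈ S_k} |L_k|`, and for each pair
`P ∈ {{1,2},{1,3},{1,4},{3,4}}` (0-indexed `{0,1},{0,2},{0,3},{2,3}`),
`∏_{j ∈ P} |M_j| ≤ ∏_{k : S_k ∩ P ≠ ∅} |L_k|`. -/
theorem example2_MAIS_cardinality_bounds
    {Mt : Fin 4 → Type} {Lt : Fin 15 → Type}
    [∀ i, Fintype (Mt i)] [∀ i, Nonempty (Mt i)] [∀ k, Fintype (Lt k)]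
    (code : MultiSenderCode 4 15 Sconf15 Aconf15 Mt Lt) :
    (∀ j : Fin 4, Fintype.card (Mt j) ≤
        ∏ k ∈ Finset.univ.filter (fun k => j ∈ Sconf15 k), Fintype.card (Lt k)) ∧
    (∀ P ∈ ({{0, 1}, {0, 2}, {0, 3}, {2, 3}} : Finset (Finset (Fin 4))),
      ∏ j ∈ P, Fintype.card (Mt j) ≤
        ∏ k ∈ Finset.univ.filter (fun k => (Sconf15 k ∩ P).Nonempty), Fintype.card (Lt k)) := by
  refine ⟨fun j => ?_, fun P hP => ?_⟩
  · have hr : ∀ j' ∈ ({j} : Finset (Fin 4)), ∀ i ∈ Aconf15 j', i ∈ ({j} : Finset (Fin 4)) →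
        (0 : ℕ) < 0 := by
      revert j; decide
    have h := code.prod_card_le_of_acyclic {j} (fun _ => 0) hr
    have hS : ∀ k, (Sconf15 k ∩ {j}).Nonempty ↔ j ∈ Sconf15 k := by
      intro k
      simp [Finset.Nonempty]
    simpa only [Finset.prod_singleton, hS] using h
  · simp only [Finset.mem_insert, Finset.mem_singleton] at hP
    rcases hP with rfl | rfl | rfl | rfl
    · exact code.prod_card_le_of_acyclic _ ![0, 0, 0, 0] (by decide)
    · exact code.prod_card_le_of_acyclic _ ![0, 0, 1, 0] (by decide)
    · exact code.prod_card_le_of_acyclic _ ![1, 0, 0, 0] (by decide)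
    · exact code.prod_card_le_of_acyclic _ ![0, 0, 0, 1] (by decide)
end

section
/- For any zero-error multi-sender index code for the four-sender configuration of Example 3 (message-index sets S_1={1,2,3}, S_2={2,3,4}, S_3={1,2}, S_4={2,4,5}; side information A_1={4,5}, A_2={1,3,5}, A_3={1,2}, A_4={2,3,5}, A_5={3}), the following cardinality bounds hold: |M_1| ≤ |L_1||L_3|, |M_3| ≤ |L_1||L_2|, |M_5| ≤ |L_4|, |M_1||M_3| ≤ |L_1||L_2||L_3|, |M_4||M_5| ≤ |L_2||L_4|, |M_1||M_2||M_5| ≤ |L_1||L_2||L_3||L_4|, |M_2||M_4||M_5| ≤ |L_1||L_2||L_3||L_4|, and |M_3||M_4||M_5| ≤ |L_1||L_2||L_4|. (These are the specialized MAIS outer bounds matching the capacity region of Example 3.) -/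
/-- The 4 sender message-index sets of Example 3 (0-indexed):
`S_1={1,2,3}`, `S_2={2,3,4}`, `S_3={1,2}`, `S_4={2,4,5}`. -/
def Sconf3 : Fin 4 → Finset (Fin 5)
  | 0 => {0, 1, 2} | 1 => {1, 2, 3} | 2 => {0, 1} | 3 => {1, 3, 4}

/-- The side information of Example 3 (0-indexed): `A_1={4,5}`, `A_2={1,3,5}`,
`A_3={1,2}`, `A_4={2,3,5}`, `A_5={3}`. -/
def Aconf3 : Fin 5 → Finset (Fin 5)
  | 0 => {3, 4} | 1 => {0, 2, 4} | 2 => {0, 1} | 3 => {1, 2, 4} | 4 => {2}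

/-- If the receivers in `T` can be ranked so that each one's side information within `T` has
smaller rank, then the messages in `T` are determined by the outputs of the senders that know
some message in `T`, once the remaining messages are fixed. -/
theorem MultiSenderCode.prod_card_le_prod_card {N K : ℕ} {S : Fin K → Finset (Fin N)}
    {A : Fin N → Finset (Fin N)} {Mt : Fin N → Type} {Lt : Fin K → Type}
    [∀ i, Fintype (Mt i)] [∀ i, Nonempty (Mt i)] [∀ k, Fintype (Lt k)]
    (code : MultiSenderCode N K S A Mt Lt) (T : Finset (Fin N)) (U : Finset (Fin K))
    (rank : Fin N → ℕ) (hrank : ∀ j ∈ T, ∀ i ∈ A j, i ∈ T → rank i < rank j)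
    (hU : ∀ k, k ∉ U → ∀ i ∈ S k, i ∉ T) :
    ∏ i ∈ T, Fintype.card (Mt i) ≤ ∏ k ∈ U, Fintype.card (Lt k) := by
  classical
  let b : ∀ i, Mt i := fun i => Classical.arbitrary (Mt i)
  let ext : ((i : T) → Mt i) → ∀ i, Mt i := fun x i => if h : i ∈ T then x ⟨i, h⟩ else b i
  let enc : ((i : T) → Mt i) → (k : U) → Lt k := fun x k => code.f k fun i => ext x i.1
  have enc_injective : Function.Injective enc := by
    intro x y hxy
    have codewords_eq : (fun k => code.f k fun i => ext x i.1) =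
        fun k => code.f k fun i => ext y i.1 := by
      funext k
      by_cases hk : k ∈ U
      · exact congrFun hxy ⟨k, hk⟩
      · congr 1
        funext i
        simp [ext, hU k hk i.1 i.2]
    have ext_eq : ∀ n j, rank j = n → ext x j = ext y j := by
      intro n
      induction n using Nat.strong_induction_on with
      | _ n ih =>
        intro j hj
        by_cases hjT : j ∈ T
        · rw [← code.correct (ext x) j, ← code.correct (ext y) j, codewords_eq]
          congr 1
          funext i
          by_cases hi : i.1 ∈ T
          · exact ih _ (hj ▸ hrank j hjT i.1 i.2 hi) i.1 rfl
          · simp [ext, hi]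
        · simp [ext, hjT]
    funext i
    simpa [ext] using ext_eq _ i.1 rfl
  have h := Fintype.card_le_of_injective enc enc_injective
  rwa [Fintype.card_pi, Fintype.card_pi, Finset.prod_coe_sort T fun i => Fintype.card (Mt i),
    Finset.prod_coe_sort U fun k => Fintype.card (Lt k)] at h

/-- The specialized MAIS outer bounds of Example 3 in zero-error combinatorial form
(0-indexed messages `M 0, …, M 4` and senders `L 0, …, L 3`). -/
theorem example3_MAIS_cardinality_bounds
    {Mt : Fin 5 → Type} {Lt : Fin 4 → Type}
    [∀ i, Fintype (Mt i)] [∀ i, Nonempty (Mt i)] [∀ k, Fintype (Lt k)]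
    (code : MultiSenderCode 5 4 Sconf3 Aconf3 Mt Lt) :
    Fintype.card (Mt 0) ≤ Fintype.card (Lt 0) * Fintype.card (Lt 2) ∧
    Fintype.card (Mt 2) ≤ Fintype.card (Lt 0) * Fintype.card (Lt 1) ∧
    Fintype.card (Mt 4) ≤ Fintype.card (Lt 3) ∧
    Fintype.card (Mt 0) * Fintype.card (Mt 2) ≤
      Fintype.card (Lt 0) * Fintype.card (Lt 1) * Fintype.card (Lt 2) ∧
    Fintype.card (Mt 3) * Fintype.card (Mt 4) ≤
      Fintype.card (Lt 1) * Fintype.card (Lt 3) ∧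
    Fintype.card (Mt 0) * Fintype.card (Mt 1) * Fintype.card (Mt 4) ≤
      Fintype.card (Lt 0) * Fintype.card (Lt 1) * Fintype.card (Lt 2) * Fintype.card (Lt 3) ∧
    Fintype.card (Mt 1) * Fintype.card (Mt 3) * Fintype.card (Mt 4) ≤
      Fintype.card (Lt 0) * Fintype.card (Lt 1) * Fintype.card (Lt 2) * Fintype.card (Lt 3) ∧
    Fintype.card (Mt 2) * Fintype.card (Mt 3) * Fintype.card (Mt 4) ≤
      Fintype.card (Lt 0) * Fintype.card (Lt 1) * Fintype.card (Lt 3) := by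
  refine ⟨?_, ?_, ?_, ?_, ?_, ?_, ?_, ?_⟩
  · simpa [mul_assoc] using code.prod_card_le_prod_card {0} {0, 2} ![0, 0, 0, 0, 0] (by decide) (by decide)
  · simpa [mul_assoc] using code.prod_card_le_prod_card {2} {0, 1} ![0, 0, 0, 0, 0] (by decide) (by decide)
  · simpa [mul_assoc] using code.prod_card_le_prod_card {4} {3} ![0, 0, 0, 0, 0] (by decide) (by decide)
  · simpa [mul_assoc] using code.prod_card_le_prod_card {0, 2} {0, 1, 2} ![0, 0, 1, 0, 0] (by decide) (by decide)
  · simpa [mul_assoc] using code.prod_card_le_prod_card {3, 4} {1, 3} ![0, 0, 0, 1, 0] (by decide) (by decide)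
  · simpa [mul_assoc] using code.prod_card_le_prod_card {0, 1, 4} {0, 1, 2, 3} ![1, 2, 0, 0, 0] (by decide) (by decide)
  · simpa [mul_assoc] using code.prod_card_le_prod_card {1, 3, 4} {0, 1, 2, 3} ![0, 1, 0, 2, 0] (by decide) (by decide)
  · simpa [mul_assoc] using code.prod_card_le_prod_card {2, 3, 4} {0, 1, 3} ![0, 0, 0, 2, 1] (by decide) (by decide)
end

section
/- Let T ⊆ ℝ⁵ be the set of tuples (R1,R2,R3,R4,R5) with all Rj ≥ 0 for which there exist nonnegative reals R_{j,1} (j=1,...,4), R_{j,2} (j=1,...,5), R_{j,3} (j=1,...,5) and nonnegative reals c11, c21, c22, c32, c13, c33 satisfying: (budgets) c11 + c13 ≤ 1, c21 + c22 ≤ 1, c32 + c33 ≤ 1; (group 1) R_{1,1} < c11, R_{4,1} < c21, R_{1,1}+R_{2,1} < c11+c21, R_{1,1}+R_{3,1} < c11+c21, R_{2,1}+R_{4,1} < c11+c21, R_{3,1}+R_{4,1} < c11+c21; (group 2) R_{3,2} < c22, R_{1,2}+R_{5,2} < c32, R_{1,2}+R_{2,2}+R_{5,2} < c22+c32, R_{1,2}+R_{4,2}+R_{5,2}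 < c22+c32, R_{2,2}+R_{4,2}+R_{5,2} < c22+c32, R_{3,2}+R_{4,2}+R_{5,2} < c22+c32; (group 3) R_{3,3} < c13, R_{1,3}+R_{3,3} < c13+c33, R_{4,3}+R_{5,3} < c33, R_{1,3}+R_{2,3}+R_{5,3} < c13+c33, R_{1,3}+R_{4,3}+R_{5,3} < c13+c33, R_{2,3}+R_{4,3}+R_{5,3} < c13+c33; and (rate splitting) Rj = R_{j,1}+R_{j,2}+R_{j,3} for j=1,...,4 and R5 = R_{5,2}+R_{5,3}. Then T equals {(R1,...,R5) ∈ ℝ⁵ : Rj ≥ 0 for all j, R3 < 2, R5 < 1, R1+R3 < 3, R1+R5 < 2, R4+R5 < 2, R1+R2+R5 < 3, R1+R4+R5 < 3, R2+R4+R5 < 3, R3+R4+R5 < 3}. -/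
/-- A nonnegative real bounded by a sum of three nonnegative reals splits into nonnegative
parts bounded by the respective summands. -/
theorem exists_nonneg_split {t x y z : ℝ} (ht : 0 ≤ t) (hx : 0 ≤ x) (hy : 0 ≤ y)
    (hz : 0 ≤ z) (h : t ≤ x + y + z) :
    ∃ u v w : ℝ, 0 ≤ u ∧ 0 ≤ v ∧ 0 ≤ w ∧ u ≤ x ∧ v ≤ y ∧ w ≤ z ∧ t = u + v + w := by
  rcases le_total t x with h₁ | h₁
  · exact ⟨t, 0, 0, ht, le_rfl, le_rfl, h₁, hy, hz, by ring⟩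
  rcases le_total t (x + y) with h₂ | h₂
  · exact ⟨x, t - x, 0, hx, by linarith, le_rfl, le_rfl, by linarith, hz, by ring⟩
  · exact ⟨x, y, t - x - y, hx, hy, by linarith, le_rfl, le_rfl, by linarith, by ring⟩

/-- The strict outer bound still holds, weakly, after shrinking all capacities by a common
factor `s < 1`. -/
theorem exists_capacity_scale {p q r t u : ℝ} (h1 : r < 2) (h2 : u < 1) (h3 : p + r < 3)
    (h4 : p + u < 2) (h5 : t + u < 2) (h6 : p + q + u < 3) (h7 : p + t + u < 3)
    (h8 : q + t + u < 3) (h9 : r + t + u < 3) :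
    ∃ s : ℝ, 0 < s ∧ s < 1 ∧ r ≤ 2 * s ∧ u ≤ s ∧ p + r ≤ 3 * s ∧ p + u ≤ 2 * s ∧
      t + u ≤ 2 * s ∧ p + q + u ≤ 3 * s ∧ p + t + u ≤ 3 * s ∧ q + t + u ≤ 3 * s ∧
      r + t + u ≤ 3 * s := by
  obtain ⟨m, hm, hm1⟩ : ∃ m : ℝ, (∀ x ∈ ({1 / 2, r / 2, u, (p + r) / 3, (p + u) / 2,
      (t + u) / 2, (p + q + u) / 3, (p + t + u) / 3, (q + t + u) / 3,
      (r + t + u) / 3} : Finset ℝ), x ≤ m) ∧ m < 1 := by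
    refine ⟨Finset.max' _ (Finset.insert_nonempty _ _), fun x hx ↦ Finset.le_max' _ x hx, ?_⟩
    rw [Finset.max'_lt_iff]
    simp only [Finset.mem_insert, Finset.mem_singleton, forall_eq_or_imp, forall_eq]
    refine ⟨?_, ?_, ?_, ?_, ?_, ?_, ?_, ?_, ?_, ?_⟩ <;> linarith
  simp only [Finset.mem_insert, Finset.mem_singleton, forall_eq_or_imp, forall_eq] at hm
  obtain ⟨k0, k1, k2, k3, k4, k5, k6, k7, k8, k9⟩ := hm
  refine ⟨m, ?_, hm1, ?_, ?_, ?_, ?_, ?_, ?_, ?_, ?_, ?_⟩ <;> linarith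

/-- Allocations `a = c₁₁` and `b = c₂₁` compatible with the outer bound at capacity `s`. -/
theorem exists_allocation {s p q r t u : ℝ} (hs : 0 < s) (hp : 0 ≤ p)
    (hu : 0 ≤ u) (h1 : r ≤ 2 * s) (h2 : u ≤ s)
    (h3 : p + r ≤ 3 * s) (h4 : p + u ≤ 2 * s) (h5 : t + u ≤ 2 * s) (h6 : p + q + u ≤ 3 * s)
    (h7 : p + t + u ≤ 3 * s) (h8 : q + t + u ≤ 3 * s) (h9 : r + t + u ≤ 3 * s) :
    ∃ a b : ℝ, 0 ≤ a ∧ a ≤ b ∧ b ≤ s ∧ r ≤ 2 * s - a ∧ p ≤ s + a ∧ t + u ≤ s + a ∧ u ≤ b ∧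
      q + u ≤ 2 * s + (b - a) ∧ p + t + u ≤ 3 * s - (b - a) := by
  obtain ⟨a, ha, ha'⟩ : ∃ a : ℝ, ((0 ≤ a ∧ p - s ≤ a) ∧ t + u - s ≤ a ∧
      p + t + 2 * u - 3 * s ≤ a) ∧ a ≤ s ∧ a ≤ 2 * s - r ∧ a ≤ 3 * s - q - u := by
    refine ⟨max (max 0 (p - s)) (max (t + u - s) (p + t + 2 * u - 3 * s)), by simp, ?_⟩
    simp only [max_le_iff]
    refine ⟨⟨⟨?_, ?_⟩, ?_, ?_⟩, ⟨⟨?_, ?_⟩, ?_, ?_⟩, ⟨?_, ?_⟩, ?_, ?_⟩ <;> linarith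
  obtain ⟨d, hd, hd'⟩ : ∃ d : ℝ, (0 ≤ d ∧ u - a ≤ d ∧ q + u - 2 * s ≤ d) ∧
      d ≤ s - a ∧ d ≤ 3 * s - p - t - u := by
    refine ⟨max 0 (max (u - a) (q + u - 2 * s)), by simp, ?_⟩
    simp only [max_le_iff]
    refine ⟨⟨?_, ?_, ?_⟩, ?_, ?_, ?_⟩ <;> linarith
  refine ⟨a, a + d, ?_, ?_, ?_, ?_, ?_, ?_, ?_, ?_, ?_⟩ <;> linarith

/-- The combined-rate-region computation of Table II for Example 4: cooperative composite
coding with joint link-and-sender partitioning into the three link-sender groups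
`{1,2}`, `{2,3}`, `{1,3}` achieves exactly the MAIS outer bound (28).
Here `R 0, …, R 4` play the roles of `R1, …, R5`; `rjg` denotes the split rate
`R_{j,g}` of message `j` in group `g`, and `ckg` denotes the link-capacity fraction
`C_{k,g}` that sender `k` allocates to group `g`. -/
theorem example4_joint_partition_region :
    {R : Fin 5 → ℝ | (∀ j, 0 ≤ R j) ∧
        ∃ r11 r21 r31 r41 r12 r22 r32 r42 r52 r13 r23 r33 r43 r53
          c11 c21 c22 c32 c13 c33 : ℝ,
          0 ≤ r11 ∧ 0 ≤ r21 ∧ 0 ≤ r31 ∧ 0 ≤ r41 ∧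
          0 ≤ r12 ∧ 0 ≤ r22 ∧ 0 ≤ r32 ∧ 0 ≤ r42 ∧ 0 ≤ r52 ∧
          0 ≤ r13 ∧ 0 ≤ r23 ∧ 0 ≤ r33 ∧ 0 ≤ r43 ∧ 0 ≤ r53 ∧
          0 ≤ c11 ∧ 0 ≤ c21 ∧ 0 ≤ c22 ∧ 0 ≤ c32 ∧ 0 ≤ c13 ∧ 0 ≤ c33 ∧
          c11 + c13 ≤ 1 ∧ c21 + c22 ≤ 1 ∧ c32 + c33 ≤ 1 ∧
          r11 < c11 ∧ r41 < c21 ∧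
          r11 + r21 < c11 + c21 ∧ r11 + r31 < c11 + c21 ∧
          r21 + r41 < c11 + c21 ∧ r31 + r41 < c11 + c21 ∧
          r32 < c22 ∧ r12 + r52 < c32 ∧
          r12 + r22 + r52 < c22 + c32 ∧ r12 + r42 + r52 < c22 + c32 ∧
          r22 + r42 + r52 < c22 + c32 ∧ r32 + r42 + r52 < c22 + c32 ∧
          r33 < c13 ∧ r13 + r33 < c13 + c33 ∧ r43 + r53 < c33 ∧
          r13 + r23 + r53 < c13 + c33 ∧ r13 + r43 + r53 < c13 + c33 ∧
          r23 + r43 + r53 < c13 + c33 ∧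
          R 0 = r11 + r12 + r13 ∧ R 1 = r21 + r22 + r23 ∧
          R 2 = r31 + r32 + r33 ∧ R 3 = r41 + r42 + r43 ∧
          R 4 = r52 + r53} =
    {R : Fin 5 → ℝ | (∀ j, 0 ≤ R j) ∧ R 2 < 2 ∧ R 4 < 1 ∧
        R 0 + R 2 < 3 ∧ R 0 + R 4 < 2 ∧ R 3 + R 4 < 2 ∧
        R 0 + R 1 + R 4 < 3 ∧ R 0 + R 3 + R 4 < 3 ∧
        R 1 + R 3 + R 4 < 3 ∧ R 2 + R 3 + R 4 < 3} := by
  ext R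
  simp only [Set.mem_ofPred_eq]
  refine and_congr_right fun hR ↦ ⟨?_, ?_⟩
  · rintro ⟨r11, r21, r31, r41, r12, r22, r32, r42, r52, r13, r23, r33, r43, r53,
      c11, c21, c22, c32, c13, c33, h⟩
    refine ⟨?_, ?_, ?_, ?_, ?_, ?_, ?_, ?_, ?_⟩ <;> linarith
  · rintro ⟨h1, h2, h3, h4, h5, h6, h7, h8, h9⟩
    have p0 := hR 0
    have q0 := hR 1
    have r0 := hR 2
    have t0 := hR 3
    have u0 := hR 4
    obtain ⟨s, hs, hs1, k1, k2, k3, k4, k5, k6, k7, k8, k9⟩ :=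
      exists_capacity_scale h1 h2 h3 h4 h5 h6 h7 h8 h9
    obtain ⟨a, b, ha, hab, hbs, b1, b2, b3, b4, b5, b6⟩ :=
      exists_allocation hs p0 u0 k1 k2 k3 k4 k5 k6 k7 k8 k9
    obtain ⟨x, hx0, hx, hx'⟩ : ∃ x, 0 ≤ x ∧ R 0 - s + (b - a) ≤ x ∧
        (x = 0 ∨ x = R 0 - s + (b - a)) :=
      ⟨max 0 _, le_max_left _ _, le_max_right _ _, max_choice _ _⟩
    obtain ⟨y, hy0, hy, hy'⟩ : ∃ y, 0 ≤ y ∧ R 1 - s ≤ y ∧ (y = 0 ∨ y = R 1 - s) :=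
      ⟨max 0 _, le_max_left _ _, le_max_right _ _, max_choice _ _⟩
    obtain ⟨z, hz0, hz, hz'⟩ : ∃ z, 0 ≤ z ∧ R 3 - s + (b - a) ≤ z ∧
        (z = 0 ∨ z = R 3 - s + (b - a)) :=
      ⟨max 0 _, le_max_left _ _, le_max_right _ _, max_choice _ _⟩
    have l1 : x ≤ b := by rcases hx' with rfl | rfl <;> linarith
    have l2 : z + R 4 ≤ b := by rcases hz' with rfl | rfl <;> linarith
    have l3 : x + y + R 4 ≤ s - a + b := by
      rcases hx' with rfl | rfl <;> rcases hy' with rfl | rfl <;> linarith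
    have l4 : x + z + R 4 ≤ s - a + b := by
      rcases hx' with rfl | rfl <;> rcases hz' with rfl | rfl <;> linarith
    have l5 : y + z + R 4 ≤ s - a + b := by
      rcases hy' with rfl | rfl <;> rcases hz' with rfl | rfl <;> linarith
    have hb : 0 ≤ b := ha.trans hab
    have hsb : 0 ≤ s - b := by linarith
    have hsa : 0 ≤ s - a := by linarith
    obtain ⟨r11, r12, r13, p1, p2, p3, p4, p5, p6, p7⟩ :=
      exists_nonneg_split p0 ha hsb hx0 (by linarith)
    obtain ⟨r21, r22, r23, q1, q2, q3, q4, q5, q6, q7⟩ :=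
      exists_nonneg_split q0 hb hsb hy0 (by linarith)
    obtain ⟨r31, r32, r33, e1, e2, e3, e4, e5, e6, e7⟩ :=
      exists_nonneg_split r0 hb hsb hsa (by linarith)
    obtain ⟨r41, r42, r43, f1, f2, f3, f4, f5, f6, f7⟩ :=
      exists_nonneg_split t0 ha hsb hz0 (by linarith)
    refine ⟨r11, r21, r31, r41, r12, r22, r32, r42, 0, r13, r23, r33, r43, R 4,
      a + (1 - s) / 2, b + (1 - s) / 2, s - b + (1 - s) / 2, s - b + (1 - s) / 2,
      s - a + (1 - s) / 2, b + (1 - s) / 2, ?_⟩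
    clear hx' hy' hz' h1 h2 h3 h4 h5 h6 h7 h8 h9 k1 k2 k3 k4 k5 k6 k7 k8 k9
    refine ⟨p1, q1, e1, f1, p2, q2, e2, f2, le_rfl, p3, q3, e3, f3, u0, ?_⟩
    and_intros <;> linarith
end

section
/- Let A = {(R1,...,R5) ∈ ℝ⁵ : Rj ≥ 0 for all j, R3 < 2, R5 < 1, R1+R3 < 3, R1+R5 < 2, R4+R5 < 2, R1+R2+R5 < 3, R1+R4+R5 < 3, R2+R4+R5 < 3, R3+R4+R5 < 3, 2R1+R2+R3+R4+2R5 < 7, 4R1+3R2+R3+3R4+4R5 < 15, 3R1+3R2+R3+4R4+4R5 < 15} and B = {(R1,...,R5) ∈ ℝ⁵ : Rj ≥ 0 for all j, R3 < 2, R5 < 1, R1+R3 < 3, R1+R5 < 2, R4+R5 < 2, R1+R2+R5 < 3, R1+R4+R5 < 3, R2+R4+R5 < 3, R3+R4+R5 < 3, R1+2R3+R4+R5 < 5}. Then the point (3/2, 1, 3/2, 1, 1/2) satisfies all the non-strict inequalities R3 ≤ 2, R5 ≤ 1, R1+R3 ≤ 3, R1+R5 ≤ 2, R4+R5 ≤ 2,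 R1+R2+R5 ≤ 3, R1+R4+R5 ≤ 3, R2+R4+R5 ≤ 3, R3+R4+R5 ≤ 3, but it does not lie in the topological closure of the convex hull of A ∪ B. -/
/-- The rate region of cooperative composite coding for Example 4 with all senders in one
group (`R 0, …, R 4` play the roles of `R1, …, R5`). -/
def Areg : Set (Fin 5 → ℝ) :=
  {R | (∀ j, 0 ≤ R j) ∧ R 2 < 2 ∧ R 4 < 1 ∧
      R 0 + R 2 < 3 ∧ R 0 + R 4 < 2 ∧ R 3 + R 4 < 2 ∧
      R 0 + R 1 + R 4 < 3 ∧ R 0 + R 3 + R 4 < 3 ∧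
      R 1 + R 3 + R 4 < 3 ∧ R 2 + R 3 + R 4 < 3 ∧
      2 * R 0 + R 1 + R 2 + R 3 + 2 * R 4 < 7 ∧
      4 * R 0 + 3 * R 1 + R 2 + 3 * R 3 + 4 * R 4 < 15 ∧
      3 * R 0 + 3 * R 1 + R 2 + 4 * R 3 + 4 * R 4 < 15}

/-- The rate region of cooperative composite coding for Example 4 under the best sender
partition `{{1,2},{3}}`. -/
def Breg : Set (Fin 5 → ℝ) :=
  {R | (∀ j, 0 ≤ R j) ∧ R 2 < 2 ∧ R 4 < 1 ∧
      R 0 + R 2 < 3 ∧ R 0 + R 4 < 2 ∧ R 3 + R 4 < 2 ∧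
      R 0 + R 1 + R 4 < 3 ∧ R 0 + R 3 + R 4 < 3 ∧
      R 1 + R 3 + R 4 < 3 ∧ R 2 + R 3 + R 4 < 3 ∧
      R 0 + 2 * R 2 + R 3 + R 4 < 5}

/-- A separating half-space: the weighted sum rate is bounded by `23 / 2` on the closed
convex hull of the two regions. -/
theorem weighted_sum_le_of_mem_closure_convexHull {R : Fin 5 → ℝ}
    (hR : R ∈ closure (convexHull ℝ (Areg ∪ Breg))) :
    3 * R 0 + R 1 + 2 * R 2 + 2 * R 3 + 3 * R 4 ≤ 23 / 2 := by
  let H : Set (Fin 5 → ℝ) :=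
    {R | 3 * R 0 + R 1 + 2 * R 2 + 2 * R 3 + 3 * R 4 ≤ 23 / 2}
  have hclosed : IsClosed H := isClosed_le (by fun_prop) (by fun_prop)
  have hconvex : Convex ℝ H := by
    refine convex_halfSpace_le ⟨fun x y => ?_, fun c x => ?_⟩ (23 / 2)
    · simp only [Pi.add_apply]
      ring
    · simp only [Pi.smul_apply, smul_eq_mul]
      ring
  have hsub : Areg ∪ Breg ⊆ H := by
    intro x hx
    simp only [Areg, Breg, H, Set.mem_union, Set.mem_ofPred_eq] at hx ⊢
    rcases hx with ⟨-, -, -, h₁, -, -, -, h₂, -, h₃, h₄, -, -⟩ |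
      ⟨-, -, -, -, -, -, h₁, h₂, -, -, h₃⟩ <;> linarith
  exact closure_minimal (convexHull_min hsub hconvex) hclosed hR

/-- The point `(3/2, 1, 3/2, 1, 1/2)` satisfies all the non-strict MAIS inequalities of
Example 4 but lies outside the closure of the convex hull of `Areg ∪ Breg`: joint
link-and-sender partitioning is necessary. -/
theorem example4_sender_partition_insufficient :
    (![(3 / 2 : ℝ), 1, 3 / 2, 1, 1 / 2]) ∈
      {R : Fin 5 → ℝ | R 2 ≤ 2 ∧ R 4 ≤ 1 ∧
          R 0 + R 2 ≤ 3 ∧ R 0 + R 4 ≤ 2 ∧ R 3 + R 4 ≤ 2 ∧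
          R 0 + R 1 + R 4 ≤ 3 ∧ R 0 + R 3 + R 4 ≤ 3 ∧
          R 1 + R 3 + R 4 ≤ 3 ∧ R 2 + R 3 + R 4 ≤ 3} ∧
    (![(3 / 2 : ℝ), 1, 3 / 2, 1, 1 / 2]) ∉ closure (convexHull ℝ (Areg ∪ Breg)) := by
  refine ⟨?_, fun h => ?_⟩
  · simp only [Set.mem_ofPred_eq, Matrix.cons_val]
    norm_num
  · have := weighted_sum_le_of_mem_closure_convexHull h
    simp only [Matrix.cons_val] at this
    norm_num at this
end
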